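/- arXiv:2006.00683 — 3 statements merged into one kernel-verified Lean document; each statement's English description precedes it below -/
import Mathlib

section
/- Let v be a random vector in ℝ^k and h a positive scalar random variable on a common probability space. Assume that E(v vᵀ), E(h v vᵀ), and E(h^{-1} v vᵀ) are all finite (entrywise integrable) and positive-definite matrices. Then, in the Loewner order, {E(h^{-1} v vᵀ)}^{-1} ≤ {E(v vᵀ)}^{-1} E(h v vᵀ) {E(v vᵀ)}^{-1}; that is, the difference {E(v vᵀ)}^{-1} E(h v vᵀ) {E(v vᵀ)}^{-1} − {E(h^{-1} v vᵀ)}^{-1} is positive semi-definite. -/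
open MeasureTheory

noncomputable section

open scoped Matrix

section WeightedSecondMoment

variable {ι Ω : Type*} [Fintype ι] [MeasurableSpace Ω] {P : Measure Ω} {v : Ω → ι → ℝ}
  {w : Ω → ℝ}

lemma mul_dotProduct_mul_dotProduct_eq_sum (a : ℝ) (u y z : ι → ℝ) :
    a * ((u ⬝ᵥ y) * (u ⬝ᵥ z)) = ∑ i, ∑ j, a * (u i * u j) * (y i * z j) := by
  rw [dotProduct, dotProduct, Finset.sum_mul_sum, Finset.mul_sum]
  simp only [Finset.mul_sum]
  exact Finset.sum_congr rfl fun i _ => Finset.sum_congr rfl fun j _ => by ring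

lemma integrable_mul_dotProduct_mul_dotProduct
    (hint : ∀ i j, Integrable (fun ω => w ω * (v ω i * v ω j)) P) (y z : ι → ℝ) :
    Integrable (fun ω => w ω * ((v ω ⬝ᵥ y) * (v ω ⬝ᵥ z))) P := by
  simp only [mul_dotProduct_mul_dotProduct_eq_sum]
  exact integrable_finsetSum _ fun i _ => integrable_finsetSum _ fun j _ =>
    (hint i j).mul_const _

lemma integral_mul_dotProduct_mul_dotProduct {M : Matrix ι ι ℝ}
    (hM : ∀ i j, M i j = ∫ ω, w ω * (v ω i * v ω j) ∂P)
    (hint : ∀ i j, Integrable (fun ω => w ω * (v ω i * v ω j)) P) (y z : ι → ℝ) :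
    ∫ ω, w ω * ((v ω ⬝ᵥ y) * (v ω ⬝ᵥ z)) ∂P = y ⬝ᵥ M *ᵥ z := by
  simp only [mul_dotProduct_mul_dotProduct_eq_sum]
  rw [integral_finsetSum _ fun i _ => integrable_finsetSum _ fun j _ =>
    (hint i j).mul_const _]
  simp only [dotProduct, Matrix.mulVec, Finset.mul_sum]
  refine Finset.sum_congr rfl fun i _ => ?_
  rw [integral_finsetSum _ fun j _ => (hint i j).mul_const _]
  refine Finset.sum_congr rfl fun j _ => ?_
  rw [integral_mul_const, ← hM]
  ring

end WeightedSecondMoment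

lemma two_mul_mul_le_mul_sq_add_inv_mul_sq {t : ℝ} (ht : 0 < t) (a b : ℝ) :
    2 * (a * b) ≤ t * (a * a) + t⁻¹ * (b * b) := by
  have key : t * (a * a) + t⁻¹ * (b * b) - 2 * (a * b) = t⁻¹ * (t * a - b) ^ 2 := by
    field_simp
    ring
  have : 0 ≤ t⁻¹ * (t * a - b) ^ 2 := by positivity
  linarith

/-- Proposition 1: for a random vector `v` and a positive scalar random variable `h`
with `E(vvᵀ)`, `E(hvvᵀ)`, `E(h⁻¹vvᵀ)` finite and positive definite, one has
`{E(h⁻¹vvᵀ)}⁻¹ ≤ {E(vvᵀ)}⁻¹ E(hvvᵀ) {E(vvᵀ)}⁻¹` in the Loewner order. -/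
theorem loewner_inequality
    (k : ℕ) (Ω : Type) [MeasurableSpace Ω] (P : Measure Ω) [IsProbabilityMeasure P]
    (v : Ω → Fin k → ℝ) (h : Ω → ℝ) (hv : Measurable v) (hh : Measurable h)
    (hpos : ∀ ω, 0 < h ω)
    (A Eh Ehinv : Matrix (Fin k) (Fin k) ℝ)
    (hA : ∀ i j, A i j = ∫ ω, v ω i * v ω j ∂P)
    (hEh : ∀ i j, Eh i j = ∫ ω, h ω * (v ω i * v ω j) ∂P)
    (hEhinv : ∀ i j, Ehinv i j = ∫ ω, (h ω)⁻¹ * (v ω i * v ω j) ∂P)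
    (hintA : ∀ i j, Integrable (fun ω => v ω i * v ω j) P)
    (hintEh : ∀ i j, Integrable (fun ω => h ω * (v ω i * v ω j)) P)
    (hintEhinv : ∀ i j, Integrable (fun ω => (h ω)⁻¹ * (v ω i * v ω j)) P)
    (hApd : A.PosDef) (hEhpd : Eh.PosDef) (hEhinvpd : Ehinv.PosDef) :
    (A⁻¹ * Eh * A⁻¹ - Ehinv⁻¹).PosSemidef := by
 
  have hform : ∀ y z : Fin k → ℝ,
      2 * (y ⬝ᵥ A *ᵥ z) ≤ y ⬝ᵥ Eh *ᵥ y + z ⬝ᵥ Ehinv *ᵥ z := by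
    intro y z
    have hA' : ∀ i j, A i j = ∫ ω, 1 * (v ω i * v ω j) ∂P := by simpa using hA
    have hintA' : ∀ i j, Integrable (fun ω => 1 * (v ω i * v ω j)) P := by simpa using hintA
    rw [← integral_mul_dotProduct_mul_dotProduct hA' hintA',
      ← integral_mul_dotProduct_mul_dotProduct hEh hintEh,
      ← integral_mul_dotProduct_mul_dotProduct hEhinv hintEhinv, ← integral_const_mul,
      ← integral_add (integrable_mul_dotProduct_mul_dotProduct hintEh y y)
        (integrable_mul_dotProduct_mul_dotProduct hintEhinv z z)]
    refine integral_mono ((integrable_mul_dotProduct_mul_dotProduct hintA' y z).const_mul 2)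
      ((integrable_mul_dotProduct_mul_dotProduct hintEh y y).add
        (integrable_mul_dotProduct_mul_dotProduct hintEhinv z z)) fun ω => ?_
    simpa using two_mul_mul_le_mul_sq_add_inv_mul_sq (hpos ω) (v ω ⬝ᵥ y) (v ω ⬝ᵥ z)
  have hAinv : A⁻¹ᴴ = A⁻¹ := hApd.isHermitian.inv
  have hAinvT : A⁻¹ᵀ = A⁻¹ := by simpa using hAinv
  have hAT : Aᵀ = A := by simpa using hApd.isHermitian.eq
  have hAdet : IsUnit A.det := (Matrix.isUnit_iff_isUnit_det A).1 hApd.isUnit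
  have hBdet : IsUnit Ehinv.det := (Matrix.isUnit_iff_isUnit_det Ehinv).1 hEhinvpd.isUnit
  refine .of_dotProduct_mulVec_nonneg (.sub ?_ hEhinvpd.isHermitian.inv) fun x => ?_
  · simpa only [hAinv] using Matrix.isHermitian_mul_mul_conjTranspose A⁻¹ hEhpd.isHermitian
  · have hx := hform (A⁻¹ *ᵥ x) (Ehinv⁻¹ *ᵥ x)
    have hcross : (A⁻¹ *ᵥ x) ⬝ᵥ A *ᵥ (Ehinv⁻¹ *ᵥ x) = x ⬝ᵥ Ehinv⁻¹ *ᵥ x := by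
      rw [Matrix.dotProduct_mulVec, ← Matrix.mulVec_transpose, hAT, Matrix.mulVec_mulVec,
        Matrix.mul_nonsing_inv _ hAdet, Matrix.one_mulVec]
    have hinv : (Ehinv⁻¹ *ᵥ x) ⬝ᵥ Ehinv *ᵥ (Ehinv⁻¹ *ᵥ x) = x ⬝ᵥ Ehinv⁻¹ *ᵥ x := by
      rw [Matrix.mulVec_mulVec, Matrix.mul_nonsing_inv _ hBdet, Matrix.one_mulVec,
        dotProduct_comm]
    have hsandwich : x ⬝ᵥ (A⁻¹ * Eh * A⁻¹) *ᵥ x = (A⁻¹ *ᵥ x) ⬝ᵥ Eh *ᵥ (A⁻¹ *ᵥ x) := by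
      rw [← Matrix.mulVec_mulVec, ← Matrix.mulVec_mulVec, Matrix.dotProduct_mulVec,
        ← Matrix.mulVec_transpose, hAinvT]
    rw [star_trivial, Matrix.sub_mulVec, dotProduct_sub, hsandwich]
    linarith
end
end

section
/- The bias-corrected under-sampled estimator is at least as efficient as the weighted one. Let x be a random vector in ℝ^d, z = (1, xᵀ)ᵀ ∈ ℝ^{d+1}, β_t ∈ ℝ^d, and c ≥ 0. Assume E(e^{β_tᵀx} z zᵀ), E(e^{β_tᵀx}(1 + c·e^{β_tᵀx}) z zᵀ), and E(e^{β_tᵀx} z zᵀ/(1 + c·e^{β_tᵀx})) are all finite and positive definite. Then, in the Loewner order, { E( e^{β_tᵀx} z zᵀ / (1 + c·e^{β_tᵀx}) ) }^{-1} ≤ { E(e^{β_tᵀx} z zᵀ) }^{-1} E( e^{β_tᵀx}(1 + c·e^{β_tᵀx}) z zᵀ ) { E(e^{β_tᵀx} z zᵀ) }^{-1}; equivalently V_bc ≤ V_sw, where V_bc and V_sw are these matrices each multiplied by the scalar E(e^{β_tᵀx}) (assumed finite and positive). -/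
open MeasureTheory

noncomputable section

/-- The augmented covariate `z = (1, xᵀ)ᵀ`. -/
def zvec {d : ℕ} (x : Fin d → ℝ) : Fin (d + 1) → ℝ := Fin.cons 1 x

/-- Dot product on `ℝ^m`. -/
def dot {m : ℕ} (a b : Fin m → ℝ) : ℝ := ∑ i, a i * b i

section WeightedGram

open Matrix

variable {Ω : Type*} [MeasurableSpace Ω] {P : Measure Ω} {ι : Type*} [Fintype ι]

lemma bilin_eq_sum (z u v : ι → ℝ) (w : ℝ) :
    w * (u ⬝ᵥ z) * (v ⬝ᵥ z) = ∑ i, ∑ j, u i * v j * (w * z i * z j) := by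
  rw [dotProduct, dotProduct, mul_assoc, Finset.sum_mul_sum, Finset.mul_sum]
  refine Finset.sum_congr rfl fun i _ => ?_
  rw [Finset.mul_sum]
  exact Finset.sum_congr rfl fun j _ => by ring

lemma integrable_bilin_of_entries {w : Ω → ℝ} {z : Ω → ι → ℝ}
    (hint : ∀ i j, Integrable (fun ω => w ω * z ω i * z ω j) P) (u v : ι → ℝ) :
    Integrable (fun ω => w ω * (u ⬝ᵥ z ω) * (v ⬝ᵥ z ω)) P := by
  simp only [bilin_eq_sum]
  exact integrable_finsetSum _ fun i _ => integrable_finsetSum _ fun j _ =>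
    (hint i j).const_mul _

lemma dotProduct_mulVec_eq_integral {M : Matrix ι ι ℝ} {w : Ω → ℝ} {z : Ω → ι → ℝ}
    (hM : ∀ i j, M i j = ∫ ω, w ω * z ω i * z ω j ∂P)
    (hint : ∀ i j, Integrable (fun ω => w ω * z ω i * z ω j) P) (u v : ι → ℝ) :
    u ⬝ᵥ M *ᵥ v = ∫ ω, w ω * (u ⬝ᵥ z ω) * (v ⬝ᵥ z ω) ∂P := by
  simp only [bilin_eq_sum]
  rw [integral_finsetSum _ fun i _ => integrable_finsetSum _ fun j _ => (hint i j).const_mul _]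
  simp only [dotProduct, mulVec, Finset.mul_sum]
  refine Finset.sum_congr rfl fun i _ => ?_
  rw [integral_finsetSum _ fun j _ => (hint i j).const_mul _]
  refine Finset.sum_congr rfl fun j _ => ?_
  rw [integral_const_mul, hM]
  ring

/-- Cauchy–Schwarz for Gram matrices with weights `f * g`, `f` and `f / g`. -/
lemma weighted_gram_form_nonneg {S M B : Matrix ι ι ℝ} {f g : Ω → ℝ} {z : Ω → ι → ℝ}
    (hf : ∀ ω, 0 ≤ f ω) (hg : ∀ ω, 0 < g ω)
    (hS : ∀ i j, S i j = ∫ ω, f ω * g ω * z ω i * z ω j ∂P)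
    (hM : ∀ i j, M i j = ∫ ω, f ω * z ω i * z ω j ∂P)
    (hB : ∀ i j, B i j = ∫ ω, f ω / g ω * z ω i * z ω j ∂P)
    (hintS : ∀ i j, Integrable (fun ω => f ω * g ω * z ω i * z ω j) P)
    (hintM : ∀ i j, Integrable (fun ω => f ω * z ω i * z ω j) P)
    (hintB : ∀ i j, Integrable (fun ω => f ω / g ω * z ω i * z ω j) P) (u v : ι → ℝ) :
    0 ≤ u ⬝ᵥ S *ᵥ u - 2 * (u ⬝ᵥ M *ᵥ v) + v ⬝ᵥ B *ᵥ v := by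
  have iS := integrable_bilin_of_entries hintS u u
  have iM := (integrable_bilin_of_entries hintM u v).const_mul 2
  have iB := integrable_bilin_of_entries hintB v v
  rw [dotProduct_mulVec_eq_integral hS hintS, dotProduct_mulVec_eq_integral hM hintM,
    dotProduct_mulVec_eq_integral hB hintB, ← integral_const_mul, ← integral_sub iS iM,
    ← integral_add (by exact iS.sub iM) iB]
  refine integral_nonneg fun ω => ?_
  have hg' := (hg ω).ne'
  have key : f ω * g ω * (u ⬝ᵥ z ω) * (u ⬝ᵥ z ω) - 2 * (f ω * (u ⬝ᵥ z ω) * (v ⬝ᵥ z ω))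
      + f ω / g ω * (v ⬝ᵥ z ω) * (v ⬝ᵥ z ω)
      = f ω / g ω * (g ω * (u ⬝ᵥ z ω) - v ⬝ᵥ z ω) ^ 2 := by
    field_simp
    ring
  exact key ▸ mul_nonneg (div_nonneg (hf ω) (hg ω).le) (sq_nonneg _)

lemma posSemidef_sandwich_sub_inv {ι : Type*} [Fintype ι] [DecidableEq ι]
    {S M B : Matrix ι ι ℝ} (hS : S.IsHermitian) (hM : M.PosDef) (hB : B.PosDef)
    (h : ∀ u v : ι → ℝ, 0 ≤ u ⬝ᵥ S *ᵥ u - 2 * (u ⬝ᵥ M *ᵥ v) + v ⬝ᵥ B *ᵥ v) :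
    (M⁻¹ * S * M⁻¹ - B⁻¹).PosSemidef := by
  have hMi : M⁻¹.IsHermitian := hM.isHermitian.inv
  have hMit : (M⁻¹)ᵀ = M⁻¹ := hMi
  have hMS : (M⁻¹ * S * M⁻¹).IsHermitian := by
    have := isHermitian_mul_mul_conjTranspose M⁻¹ hS
    rwa [hMi.eq] at this
  refine .of_dotProduct_mulVec_nonneg (hMS.sub hB.isHermitian.inv) fun x => ?_
  have hMdet := (isUnit_iff_isUnit_det _).mp hM.isUnit
  have hBdet := (isUnit_iff_isUnit_det _).mp hB.isUnit
  have key := h (M⁻¹ *ᵥ x) (B⁻¹ *ᵥ x)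
  have left (y : ι → ℝ) : (M⁻¹ *ᵥ x) ⬝ᵥ y = x ⬝ᵥ M⁻¹ *ᵥ y := by
    rw [dotProduct_mulVec, ← mulVec_transpose, hMit]
  rw [left, left] at key
  simp only [mulVec_mulVec, ← Matrix.mul_assoc, nonsing_inv_mul _ hMdet, Matrix.one_mul,
    mul_nonsing_inv _ hBdet, one_mulVec, dotProduct_comm (B⁻¹ *ᵥ x) x] at key
  rw [star_trivial, sub_mulVec, dotProduct_sub]
  linarith

end WeightedGram

/-- The bias-corrected under-sampled estimator is at least as efficient as the weighted
one: `{E(e^{βᵀx}zzᵀ/(1+ce^{βᵀx}))}⁻¹ ≤ {E(e^{βᵀx}zzᵀ)}⁻¹ E(e^{βᵀx}(1+ce^{βᵀx})zzᵀ)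
{E(e^{βᵀx}zzᵀ)}⁻¹` in the Loewner order; equivalently `V_bc ≤ V_sw` after multiplying
by the scalar `E(e^{βᵀx})`. -/
theorem undersampled_bc_more_efficient_than_weighted
    (d : ℕ) (Ω : Type) [MeasurableSpace Ω] (P : Measure Ω) [IsProbabilityMeasure P]
    (x : Ω → Fin d → ℝ) (hx : Measurable x)
    (βt : Fin d → ℝ) (c : ℝ) (hc : 0 ≤ c)
    (Mf Msw Mbc : Matrix (Fin (d + 1)) (Fin (d + 1)) ℝ)
    (hMf : ∀ i j, Mf i j = ∫ ω, Real.exp (dot βt (x ω)) * zvec (x ω) i * zvec (x ω) j ∂P)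
    (hMsw : ∀ i j, Msw i j = ∫ ω, Real.exp (dot βt (x ω)) * (1 + c * Real.exp (dot βt (x ω)))
        * zvec (x ω) i * zvec (x ω) j ∂P)
    (hMbc : ∀ i j, Mbc i j = ∫ ω, Real.exp (dot βt (x ω)) * zvec (x ω) i * zvec (x ω) j
        / (1 + c * Real.exp (dot βt (x ω))) ∂P)
    (hintMf : ∀ i j, Integrable
        (fun ω => Real.exp (dot βt (x ω)) * zvec (x ω) i * zvec (x ω) j) P)
    (hintMsw : ∀ i j, Integrable
        (fun ω => Real.exp (dot βt (x ω)) * (1 + c * Real.exp (dot βt (x ω)))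
          * zvec (x ω) i * zvec (x ω) j) P)
    (hintMbc : ∀ i j, Integrable
        (fun ω => Real.exp (dot βt (x ω)) * zvec (x ω) i * zvec (x ω) j
          / (1 + c * Real.exp (dot βt (x ω)))) P)
    (hMfpd : Mf.PosDef) (hMswpd : Msw.PosDef) (hMbcpd : Mbc.PosDef)
    (hintE : Integrable (fun ω => Real.exp (dot βt (x ω))) P)
    (hEpos : 0 < ∫ ω, Real.exp (dot βt (x ω)) ∂P) :
    (Mf⁻¹ * Msw * Mf⁻¹ - Mbc⁻¹).PosSemidef ∧
      ((∫ ω, Real.exp (dot βt (x ω)) ∂P) • (Mf⁻¹ * Msw * Mf⁻¹)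
        - (∫ ω, Real.exp (dot βt (x ω)) ∂P) • Mbc⁻¹).PosSemidef := by
  have key : (Mf⁻¹ * Msw * Mf⁻¹ - Mbc⁻¹).PosSemidef := by
    refine posSemidef_sandwich_sub_inv hMswpd.isHermitian hMfpd hMbcpd
      (weighted_gram_form_nonneg (fun ω => (Real.exp_pos (dot βt (x ω))).le)
        (g := fun ω => 1 + c * Real.exp (dot βt (x ω))) (fun ω => by positivity)
        hMsw hMf (fun i j => ?_) hintMsw hintMf (fun i j => ?_))
    · simpa only [div_mul_eq_mul_div] using hMbc i j
    · simpa only [div_mul_eq_mul_div] using hintMbc i j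
  exact ⟨key, smul_sub (∫ ω, Real.exp (dot βt (x ω)) ∂P) (Mf⁻¹ * Msw * Mf⁻¹) Mbc⁻¹ ▸
    key.smul hEpos.le⟩
end
end

section
/- The bias-corrected over-sampled estimator is at most as efficient as the weighted one. Let x be a random vector in ℝ^d, z = (1, xᵀ)ᵀ ∈ ℝ^{d+1}, β_t ∈ ℝ^d, and c_o ≥ 0. Assume M_f = E(e^{β_tᵀx} z zᵀ), M_{obc1} = E( e^{β_tᵀx} z zᵀ / (1 + c_o e^{β_tᵀx})² ), and M_{obc2} = E( e^{β_tᵀx} z zᵀ / (1 + c_o e^{β_tᵀx}) ) are all finite and positive definite. Then, in the Loewner order, M_{obc2}^{-1} M_{obc1} M_{obc2}^{-1} ≥ M_f^{-1}; equivalently V_obc ≥ V_ow, where V_obc and V_ow are these matrices each multiplied by the same positive scalar [((1+λ)²+λ)/(1+λ)²]·E(e^{β_tᵀx}). -/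
open MeasureTheory

noncomputable section

open Matrix in
/-- If the symmetric block matrix with blocks `A`, `B`, `B`, `C` is positive semidefinite as a
quadratic form, then `A⁻¹ ≤ B⁻¹ * C * B⁻¹` in the Loewner order. -/
theorem posSemidef_inv_mul_mul_inv_sub_inv {n : Type*} [Fintype n] [DecidableEq n]
    {A B C : Matrix n n ℝ} (hA : A.PosDef) (hB : B.PosDef) (hC : C.IsHermitian)
    (h : ∀ u w : n → ℝ, 0 ≤ u ⬝ᵥ (A *ᵥ u) + 2 * (u ⬝ᵥ (B *ᵥ w)) + w ⬝ᵥ (C *ᵥ w)) :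
    (B⁻¹ * C * B⁻¹ - A⁻¹).PosSemidef := by
  have hAdet : IsUnit A.det := (Matrix.isUnit_iff_isUnit_det A).1 hA.isUnit
  have hBdet : IsUnit B.det := (Matrix.isUnit_iff_isUnit_det B).1 hB.isUnit
  have hBinv : B⁻¹ᴴ = B⁻¹ := hB.isHermitian.inv.eq
  have hBC : (B⁻¹ * C * B⁻¹).IsHermitian := by
    have := isHermitian_mul_mul_conjTranspose B⁻¹ hC
    rwa [hBinv] at this
  refine .of_dotProduct_mulVec_nonneg (hBC.sub hA.isHermitian.inv) fun v => ?_
  have key := h (-(A⁻¹ *ᵥ v)) (B⁻¹ *ᵥ v)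
  have hAA : A *ᵥ (A⁻¹ *ᵥ v) = v := by rw [mulVec_mulVec, mul_nonsing_inv _ hAdet, one_mulVec]
  have hBB : B *ᵥ (B⁻¹ *ᵥ v) = v := by rw [mulVec_mulVec, mul_nonsing_inv _ hBdet, one_mulVec]
  have hC' : (B⁻¹ *ᵥ v) ⬝ᵥ (C *ᵥ (B⁻¹ *ᵥ v)) = v ⬝ᵥ ((B⁻¹ * C * B⁻¹) *ᵥ v) := by
    rw [conjTranspose_eq_transpose_of_trivial] at hBinv
    conv_lhs => enter [1]; rw [← hBinv, mulVec_transpose]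
    rw [← dotProduct_mulVec, mulVec_mulVec, mulVec_mulVec, Matrix.mul_assoc]
  rw [mulVec_neg, hAA, hBB, hC'] at key
  simp only [neg_dotProduct, dotProduct_neg, neg_neg] at key
  rw [dotProduct_comm (A⁻¹ *ᵥ v) v] at key
  simp only [star_trivial, sub_mulVec, dotProduct_sub]
  linarith

open Matrix in
/-- If the `2 × 2` matrix with entries `a ω`, `b ω`, `b ω`, `c ω` is positive semidefinite for every
`ω`, then so is the block form built from the moment matrices `E(a zzᵀ)`, `E(b zzᵀ)`, `E(c zzᵀ)`. -/
theorem moment_block_form_nonneg {n Ω : Type*} [Fintype n] [MeasurableSpace Ω] {P : Measure Ω}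
    {z : Ω → n → ℝ} {a b c : Ω → ℝ} {A B C : Matrix n n ℝ}
    (hA : ∀ i j, A i j = ∫ ω, a ω * z ω i * z ω j ∂P)
    (hB : ∀ i j, B i j = ∫ ω, b ω * z ω i * z ω j ∂P)
    (hC : ∀ i j, C i j = ∫ ω, c ω * z ω i * z ω j ∂P)
    (hAi : ∀ i j, Integrable (fun ω => a ω * z ω i * z ω j) P)
    (hBi : ∀ i j, Integrable (fun ω => b ω * z ω i * z ω j) P)
    (hCi : ∀ i j, Integrable (fun ω => c ω * z ω i * z ω j) P)
    (habc : ∀ ω (s t : ℝ), 0 ≤ a ω * s ^ 2 + 2 * (b ω * s * t) + c ω * t ^ 2)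
    (u w : n → ℝ) :
    0 ≤ u ⬝ᵥ (A *ᵥ u) + 2 * (u ⬝ᵥ (B *ᵥ w)) + w ⬝ᵥ (C *ᵥ w) := by
  have form : ∀ {m : Ω → ℝ} {M : Matrix n n ℝ} (_ : ∀ i j, M i j = ∫ ω, m ω * z ω i * z ω j ∂P)
      (_ : ∀ i j, Integrable (fun ω => m ω * z ω i * z ω j) P) (p q : n → ℝ),
      Integrable (fun ω => m ω * (p ⬝ᵥ z ω) * (q ⬝ᵥ z ω)) P ∧
        p ⬝ᵥ (M *ᵥ q) = ∫ ω, m ω * (p ⬝ᵥ z ω) * (q ⬝ᵥ z ω) ∂P := by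
    intro m M hM hMi p q
    have expand : (fun ω => m ω * (p ⬝ᵥ z ω) * (q ⬝ᵥ z ω)) =
        fun ω => ∑ i, ∑ j, p i * q j * (m ω * z ω i * z ω j) := by
      ext ω
      simp only [dotProduct]
      rw [mul_assoc, Finset.sum_mul_sum, Finset.mul_sum]
      simp only [Finset.mul_sum]
      exact Finset.sum_congr rfl fun i _ => Finset.sum_congr rfl fun j _ => by ring
    have hi : ∀ i j, Integrable (fun ω => p i * q j * (m ω * z ω i * z ω j)) P :=
      fun i j => (hMi i j).const_mul _
    rw [expand]
    refine ⟨integrable_finsetSum _ fun i _ => integrable_finsetSum _ fun j _ => hi i j, ?_⟩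
    rw [integral_finsetSum _ fun i _ => integrable_finsetSum _ fun j _ => hi i j]
    simp only [dotProduct, mulVec, Finset.mul_sum]
    refine Finset.sum_congr rfl fun i _ => ?_
    rw [integral_finsetSum _ fun j _ => hi i j]
    refine Finset.sum_congr rfl fun j _ => ?_
    rw [integral_const_mul, hM]
    ring
  obtain ⟨iA, eA⟩ := form hA hAi u u
  obtain ⟨iB, eB⟩ := form hB hBi u w
  obtain ⟨iC, eC⟩ := form hC hCi w w
  have iAB : Integrable (fun ω => a ω * (u ⬝ᵥ z ω) * (u ⬝ᵥ z ω) +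
      2 * (b ω * (u ⬝ᵥ z ω) * (w ⬝ᵥ z ω))) P := iA.add (iB.const_mul 2)
  rw [eA, eB, eC, ← integral_const_mul, ← integral_add iA (iB.const_mul 2), ← integral_add iAB iC]
  refine integral_nonneg fun ω => ?_
  have := habc ω (u ⬝ᵥ z ω) (w ⬝ᵥ z ω)
  simp only [Pi.zero_apply]
  linarith

/-- The bias-corrected over-sampled estimator is at most as efficient as the weighted
one: `M_{obc2}⁻¹ M_{obc1} M_{obc2}⁻¹ ≥ M_f⁻¹` in the Loewner order; equivalently
`V_obc ≥ V_ow` after multiplying by the positive scalar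
`[((1+λ)²+λ)/(1+λ)²]·E(e^{βᵀx})`. -/
theorem oversampled_bc_less_efficient_than_weighted
    (d : ℕ) (Ω : Type) [MeasurableSpace Ω] (P : Measure Ω) [IsProbabilityMeasure P]
    (x : Ω → Fin d → ℝ) (hx : Measurable x)
    (βt : Fin d → ℝ) (co lam : ℝ) (hco : 0 ≤ co) (hlam : 0 ≤ lam)
    (Mf Mobc1 Mobc2 : Matrix (Fin (d + 1)) (Fin (d + 1)) ℝ)
    (hMf : ∀ i j, Mf i j = ∫ ω, Real.exp (dot βt (x ω)) * zvec (x ω) i * zvec (x ω) j ∂P)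
    (hMobc1 : ∀ i j, Mobc1 i j = ∫ ω, Real.exp (dot βt (x ω)) * zvec (x ω) i * zvec (x ω) j
        / (1 + co * Real.exp (dot βt (x ω))) ^ 2 ∂P)
    (hMobc2 : ∀ i j, Mobc2 i j = ∫ ω, Real.exp (dot βt (x ω)) * zvec (x ω) i * zvec (x ω) j
        / (1 + co * Real.exp (dot βt (x ω))) ∂P)
    (hintMf : ∀ i j, Integrable
        (fun ω => Real.exp (dot βt (x ω)) * zvec (x ω) i * zvec (x ω) j) P)
    (hintMobc1 : ∀ i j, Integrable
        (fun ω => Real.exp (dot βt (x ω)) * zvec (x ω) i * zvec (x ω) j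
          / (1 + co * Real.exp (dot βt (x ω))) ^ 2) P)
    (hintMobc2 : ∀ i j, Integrable
        (fun ω => Real.exp (dot βt (x ω)) * zvec (x ω) i * zvec (x ω) j
          / (1 + co * Real.exp (dot βt (x ω)))) P)
    (hMfpd : Mf.PosDef) (hMobc1pd : Mobc1.PosDef) (hMobc2pd : Mobc2.PosDef)
    (hintE : Integrable (fun ω => Real.exp (dot βt (x ω))) P)
    (hEpos : 0 < ∫ ω, Real.exp (dot βt (x ω)) ∂P) :
    (Mobc2⁻¹ * Mobc1 * Mobc2⁻¹ - Mf⁻¹).PosSemidef ∧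
      ((((1 + lam) ^ 2 + lam) / (1 + lam) ^ 2 * ∫ ω, Real.exp (dot βt (x ω)) ∂P) •
          (Mobc2⁻¹ * Mobc1 * Mobc2⁻¹)
        - (((1 + lam) ^ 2 + lam) / (1 + lam) ^ 2 * ∫ ω, Real.exp (dot βt (x ω)) ∂P) •
          Mf⁻¹).PosSemidef := by
  have main : (Mobc2⁻¹ * Mobc1 * Mobc2⁻¹ - Mf⁻¹).PosSemidef := by
    have swap : ∀ e p q r : ℝ, e * p * q / r = e / r * p * q := fun e p q r => by ring
    simp only [swap] at hMobc1 hMobc2 hintMobc1 hintMobc2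
    refine posSemidef_inv_mul_mul_inv_sub_inv hMfpd hMobc2pd hMobc1pd.isHermitian
      (moment_block_form_nonneg hMf hMobc2 hMobc1 hintMf hintMobc2 hintMobc1 fun ω s t => ?_)
    have hsq : ∀ e h : ℝ, e * s ^ 2 + 2 * (e / h * s * t) + e / h ^ 2 * t ^ 2
        = e * (s + t / h) ^ 2 := fun e h => by ring
    rw [hsq]
    positivity
  refine ⟨main, ?_⟩
  rw [← smul_sub]
  exact main.smul (by positivity)
end
end
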